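/- Let n ≥ 2, 0 < λ ≤ Λ, M = 2√(n−1)(1 + 2√((n−1)Λ/λ)), and 0 < δ ≤ 1/M. Then for every x ∈ ℝⁿ with xₙ ≤ 1/M, the vertical derivative of the function ψ(x) = δ + 4n(M + δ/(λM))(xₙ + δ) − n(M² + δ/λ)·xₙ(xₙ + δ) + (λ/(2Λ(n−1))) ∑_{i=1}^{n−1} ((M|xᵢ| − 1)⁺)^{2+ε₀} satisfies ∂ψ/∂xₙ(x) = 4n(M + δ/(λM)) − n(M² + δ/λ)(2xₙ + δ) ≥ nM. -/

import Mathlib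

open Metric

noncomputable section

abbrev Eu (n : ℕ) := EuclideanSpace ℝ (Fin n)

/-- The last coordinate `xₙ` of a point `x ∈ ℝⁿ`. -/
def lastCoord {n : ℕ} (x : Eu n) : ℝ :=
  if h : 0 < n then x ⟨n - 1, Nat.sub_lt h Nat.one_pos⟩ else 0

/-- The barrier function
`ψ(x) = δ + 4n(M + δ/(λM))(xₙ + δ) − n(M² + δ/λ) xₙ(xₙ + δ)
        + (λ/(2Λ(n−1))) ∑_{i=1}^{n−1} ((M|xᵢ| − 1)⁺)^{2+ε₀}`. -/
def psi (n : ℕ) (lam Lam M δ ε₀ : ℝ) (x : Eu n) : ℝ :=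
  δ + 4 * n * (M + δ / (lam * M)) * (lastCoord x + δ)
    - n * (M ^ 2 + δ / lam) * lastCoord x * (lastCoord x + δ)
    + lam / (2 * Lam * ((n : ℝ) - 1)) *
        ∑ i ∈ Finset.univ.filter (fun i : Fin n => (i : ℕ) < n - 1),
          max (M * |x i| - 1) 0 ^ (2 + ε₀)


/-- For `1 < p`, the function `s ↦ (s⁺)^p` is differentiable. -/
theorem differentiable_max_zero_rpow {p : ℝ} (hp : 1 < p) :
    Differentiable ℝ fun s : ℝ => max s 0 ^ p := by
  intro s
  rcases lt_trichotomy s 0 with hs | rfl | hs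
  · have h : (fun s : ℝ => max s 0 ^ p) =ᶠ[nhds s] fun _ => (0 : ℝ) := by
      filter_upwards [Iio_mem_nhds hs] with t ht
      rw [max_eq_right (le_of_lt ht), Real.zero_rpow (by linarith)]
    exact (differentiableAt_const _).congr_of_eventuallyEq h
  · have hpos : HasDerivWithinAt (fun s : ℝ => max s 0 ^ p) 0 (Set.Ici 0) 0 := by
      have h := (Real.hasDerivAt_rpow_const (x := 0) (p := p) (Or.inr hp.le)).hasDerivWithinAt
        (s := Set.Ici 0)
      rw [Real.zero_rpow (by linarith), mul_zero] at h
      exact h.congr (fun t ht => by rw [max_eq_left ht]) (by simp)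
    have hneg : HasDerivWithinAt (fun s : ℝ => max s 0 ^ p) 0 (Set.Iic 0) 0 := by
      refine (hasDerivWithinAt_const (0 : ℝ) (Set.Iic 0) (0 : ℝ)).congr (fun t ht => ?_) ?_
      · rw [max_eq_right ht, Real.zero_rpow (by linarith)]
      · rw [max_self, Real.zero_rpow (by linarith)]
    have h := hneg.union hpos
    rw [Set.Iic_union_Ici, hasDerivWithinAt_univ] at h
    exact h.differentiableAt
  · have h : (fun s : ℝ => max s 0 ^ p) =ᶠ[nhds s] fun s => s ^ p := by
      filter_upwards [Ioi_mem_nhds hs] with t ht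
      rw [max_eq_left (le_of_lt ht)]
    exact (Real.hasDerivAt_rpow_const (Or.inr hp.le)).differentiableAt.congr_of_eventuallyEq h

theorem max_mul_abs_sub_one_rpow {M p : ℝ} (hM : 0 ≤ M) (hp : p ≠ 0) (t : ℝ) :
    max (M * |t| - 1) 0 ^ p = max (M * t - 1) 0 ^ p + max (-(M * t) - 1) 0 ^ p := by
  rcases le_total 0 t with ht | ht
  · have h : -(M * t) - 1 ≤ 0 := by nlinarith [mul_nonneg hM ht]
    rw [abs_of_nonneg ht, max_eq_right h, Real.zero_rpow hp, add_zero]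
  · have h : M * t - 1 ≤ 0 := by nlinarith [mul_nonneg hM (neg_nonneg.2 ht)]
    rw [abs_of_nonpos ht, max_eq_right h, Real.zero_rpow hp, zero_add, mul_neg]

theorem differentiable_max_mul_abs_sub_one_rpow {M p : ℝ} (hM : 0 ≤ M) (hp : 1 < p) :
    Differentiable ℝ fun t : ℝ => max (M * |t| - 1) 0 ^ p := by
  simp_rw [max_mul_abs_sub_one_rpow hM (by linarith : p ≠ 0)]
  exact ((differentiable_max_zero_rpow hp).comp (g := fun s : ℝ => max s 0 ^ p)
      (f := fun t => M * t - 1) (by fun_prop)).add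
    ((differentiable_max_zero_rpow hp).comp (g := fun s : ℝ => max s 0 ^ p)
      (f := fun t => -(M * t) - 1) (by fun_prop))

theorem lastCoord_eq {n : ℕ} (hn : 0 < n) (x : Eu n) :
    lastCoord x = x ⟨n - 1, Nat.sub_lt hn Nat.one_pos⟩ :=
  dif_pos hn

theorem differentiable_lastCoord (n : ℕ) : Differentiable ℝ (lastCoord : Eu n → ℝ) := by
  unfold lastCoord
  split_ifs <;> fun_prop

theorem differentiable_psi (n : ℕ) (lam Lam δ : ℝ) {M ε₀ : ℝ} (hM : 0 ≤ M) (hε₀ : 0 < ε₀) :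
    Differentiable ℝ (psi n lam Lam M δ ε₀) := by
  have hlast := differentiable_lastCoord n
  have hterm (i : Fin n) : Differentiable ℝ fun x : Eu n => max (M * |x i| - 1) 0 ^ (2 + ε₀) :=
    (differentiable_max_mul_abs_sub_one_rpow hM (by linarith : 1 < 2 + ε₀)).comp
      (g := fun t : ℝ => max (M * |t| - 1) 0 ^ (2 + ε₀)) (f := fun x : Eu n => x i) (by fun_prop)
  have hsum : Differentiable ℝ fun x : Eu n =>
      ∑ i ∈ Finset.univ.filter (fun i : Fin n => (i : ℕ) < n - 1),
        max (M * |x i| - 1) 0 ^ (2 + ε₀) :=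
    Differentiable.fun_sum fun i _ => hterm i
  unfold psi
  fun_prop

theorem lastCoord_add_smul_single {n : ℕ} (hn : 0 < n) (x : Eu n) (t : ℝ) :
    lastCoord (x + t • EuclideanSpace.single ⟨n - 1, Nat.sub_lt hn Nat.one_pos⟩ 1)
      = lastCoord x + t := by
  simp [lastCoord_eq hn]

/-- Moving in the last direction changes only the polynomial part of the barrier. -/
theorem psi_add_smul_single {n : ℕ} (hn : 0 < n) (lam Lam M δ ε₀ : ℝ) (x : Eu n) (t : ℝ) :
    psi n lam Lam M δ ε₀
        (x + t • EuclideanSpace.single ⟨n - 1, Nat.sub_lt hn Nat.one_pos⟩ 1)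
      = psi n lam Lam M δ ε₀ x + (4 * n * (M + δ / (lam * M)) -
          n * (M ^ 2 + δ / lam) * (2 * lastCoord x + δ)) * t
        - n * (M ^ 2 + δ / lam) * t ^ 2 := by
  have hsum : ∑ i ∈ Finset.univ.filter (fun i : Fin n => (i : ℕ) < n - 1),
        max (M * |(x + t • EuclideanSpace.single
          (⟨n - 1, Nat.sub_lt hn Nat.one_pos⟩ : Fin n) (1 : ℝ) : Eu n) i| - 1) 0 ^ (2 + ε₀)
      = ∑ i ∈ Finset.univ.filter (fun i : Fin n => (i : ℕ) < n - 1),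
        max (M * |x i| - 1) 0 ^ (2 + ε₀) := by
    refine Finset.sum_congr rfl fun i hi => ?_
    have hne : i ≠ ⟨n - 1, Nat.sub_lt hn Nat.one_pos⟩ :=
      fun h => (Finset.mem_filter.1 hi).2.ne (congrArg Fin.val h)
    simp [hne]
  unfold psi
  rw [hsum, lastCoord_add_smul_single hn]
  ring

theorem fderiv_psi_single {n : ℕ} (hn : 0 < n) (lam Lam δ : ℝ) {M ε₀ : ℝ} (hM : 0 ≤ M)
    (hε₀ : 0 < ε₀) (x : Eu n) :
    fderiv ℝ (psi n lam Lam M δ ε₀) x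
        (EuclideanSpace.single ⟨n - 1, Nat.sub_lt hn Nat.one_pos⟩ 1)
      = 4 * n * (M + δ / (lam * M)) - n * (M ^ 2 + δ / lam) * (2 * lastCoord x + δ) := by
  rw [← (differentiable_psi n lam Lam δ hM hε₀ x).lineDeriv_eq_fderiv, lineDeriv]
  simp_rw [psi_add_smul_single hn]
  have h := (((hasDerivAt_id (0 : ℝ)).const_mul (4 * n * (M + δ / (lam * M)) -
    n * (M ^ 2 + δ / lam) * (2 * lastCoord x + δ))).const_add (psi n lam Lam M δ ε₀ x)).fun_sub
    (((hasDerivAt_id (0 : ℝ)).pow 2).const_mul (n * (M ^ 2 + δ / lam)))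
  simpa using h.deriv

theorem le_vertical_slope {n lam M δ z : ℝ} (hn : 0 ≤ n) (hlam : 0 < lam) (hM : 0 < M)
    (hδ : 0 ≤ δ) (hδM : δ ≤ 1 / M) (hz : z ≤ 1 / M) :
    n * M ≤ 4 * n * (M + δ / (lam * M)) - n * (M ^ 2 + δ / lam) * (2 * z + δ) := by
  have hc : 0 ≤ n * (M ^ 2 + δ / lam) := by positivity
  have hle : n * (M ^ 2 + δ / lam) * (2 * z + δ) ≤ n * (M ^ 2 + δ / lam) * (3 * (1 / M)) :=
    mul_le_mul_of_nonneg_left (by linarith) hc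
  have heq : n * (M ^ 2 + δ / lam) * (3 * (1 / M)) = 3 * (n * M) + 3 * (n * (δ / (lam * M))) := by
    field_simp
  have hpos : 0 ≤ n * (δ / (lam * M)) := by positivity
  linarith

/-- the vertical derivative of the barrier `ψ` satisfies
`∂ψ/∂xₙ(x) = 4n(M + δ/(λM)) − n(M² + δ/λ)(2xₙ + δ) ≥ nM` for `xₙ ≤ 1/M`. -/
theorem stmt14 (n : ℕ) (hn : 2 ≤ n) (lam Lam : ℝ) (hlam : 0 < lam) (hLam : lam ≤ Lam)
    (M : ℝ)
    (hM : M = 2 * Real.sqrt ((n : ℝ) - 1) *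
      (1 + 2 * Real.sqrt (((n : ℝ) - 1) * Lam / lam)))
    (ε₀ : ℝ) (hε₀ : 0 < ε₀) (δ : ℝ) (hδ : 0 < δ) (hδM : δ ≤ 1 / M)
    (x : Eu n) (hxn : lastCoord x ≤ 1 / M) :
    fderiv ℝ (psi n lam Lam M δ ε₀) x (EuclideanSpace.single ⟨n - 1, by omega⟩ 1)
        = 4 * n * (M + δ / (lam * M)) - n * (M ^ 2 + δ / lam) * (2 * lastCoord x + δ) ∧
    (n : ℝ) * M ≤ 4 * n * (M + δ / (lam * M))
        - n * (M ^ 2 + δ / lam) * (2 * lastCoord x + δ) := by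
  have hn1 : (0 : ℝ) < (n : ℝ) - 1 := by
    have : (2 : ℝ) ≤ n := by exact_mod_cast hn
    linarith
  have hMpos : 0 < M := by
    rw [hM]
    positivity
  exact ⟨fderiv_psi_single (by omega) lam Lam δ hMpos.le hε₀ x,
    le_vertical_slope n.cast_nonneg hlam hMpos hδ.le hδM hxn⟩

end
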